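/- Let α ∈ F_{2^n} satisfy tr(α + 1) = 0, and suppose d = gcd(2i, n) = gcd(i, n) < n (equivalently, n/d > 1 is odd where d = gcd(i, n)). Then for every c ∈ F_{2^d} \ F_2, the function G_α(x) = (x + tr(αx + x^{2^i+1}))^{2^i+1} is a permutation of F_{2^n} whose c-differential uniformity equals 2 (i.e., G_α is an APcN permutation). -/

import Mathlib

/-- The absolute trace from `F_{2^n}` to its prime field, computed inside the field. -/
noncomputable def aTr {K : Type} [CommRing K] (n : ℕ) (x : K) : K :=
  ∑ k ∈ Finset.range n, x ^ 2 ^ k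

/-- The `c`-differential uniformity of `F`. -/
noncomputable def cDelta {K : Type} [Field K] (c : K) (F : K → K) : ℕ :=
  sSup { k : ℕ | ∃ a b : K, (c = 1 → a ≠ 0) ∧
    k = Nat.card {x : K // F (x + a) + c * F x = b} }

/-- When `σ` has odd order, every element is of the form `σ a + a + r` with `r` fixed. -/
lemma exists_map_add_add_fixed {R : Type} [CommRing R] {σ : R →+* R} {k : ℕ}
    (hord : ∀ x, σ^[2 * k + 1] x = x) (z : R) :
    ∃ a r, σ r = r ∧ σ a + a = z + r := by
  have hsum : ∀ m, σ (∑ j ∈ Finset.range m, σ^[j] z) + z = (∑ j ∈ Finset.range m, σ^[j] z)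
      + σ^[m] z := by
    intro m
    rw [map_sum, ← Finset.sum_range_succ, Finset.sum_range_succ']
    simp only [Function.iterate_succ_apply', Function.iterate_zero, id]
  have heven : ∀ m, σ (∑ j ∈ Finset.range m, σ^[2 * j] z) + ∑ j ∈ Finset.range m, σ^[2 * j] z
      = ∑ j ∈ Finset.range (2 * m), σ^[j] z := by
    intro m
    induction m with
    | zero => simp
    | succ m ih =>
      rw [Finset.sum_range_succ, map_add, mul_add_one, Finset.sum_range_succ _ (2 * m + 1),
        Finset.sum_range_succ _ (2 * m), ← ih, Function.iterate_succ_apply']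
      ring
  refine ⟨∑ j ∈ Finset.range (k + 1), σ^[2 * j] z, ∑ j ∈ Finset.range (2 * k + 1), σ^[j] z,
    ?_, ?_⟩
  · have := hsum (2 * k + 1)
    rw [hord] at this
    exact add_right_cancel this
  · rw [heven, mul_add_one, Finset.sum_range_succ _ (2 * k + 1), hord, add_comm]

section CharTwo

variable {K : Type} [Field K] [CharP K 2] {σ : K →+* K} {tr : K →+ K}

/-- If the fixed points of `σ ∘ σ` are those of `σ`, the norm-like map `x ↦ σ x * x` is injective. -/
lemma injective_map_mul_self (hσ : ∀ x, σ (σ x) = x → σ x = x) :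
    Function.Injective fun x => σ x * x := by
  intro x y hxy
  simp only at hxy
  by_cases hy : y = 0
  · subst hy
    simpa using hxy
  have hσy : σ y ≠ 0 := by simpa using hy
  have hquot : σ (x / y) * (x / y) = 1 := by
    rw [map_div₀]
    field_simp
    exact hxy
  have hne : σ (x / y) ≠ 0 := left_ne_zero_of_mul_eq_one hquot
  have hσquot : σ (σ (x / y)) * σ (x / y) = 1 := by
    rw [← map_mul, hquot, map_one]
  have hfix : σ (x / y) = x / y :=
    hσ _ (mul_right_cancel₀ hne (by rw [hσquot, ← hquot, mul_comm]))
  rw [hfix] at hquot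
  have hone : x / y = 1 := by
    have : (x / y + 1) ^ 2 = 0 := by grind
    have := pow_eq_zero_iff (two_ne_zero) |>.1 this
    grind
  exact (div_eq_one_iff_eq hy).1 hone

/-- Adding to `x` a `{0, 1}`-valued function of period one is an involution. -/
lemma involutive_add_of_periodic {T : K → K} (hT : ∀ x, T x = 0 ∨ T x = 1)
    (hper : ∀ x, T (x + 1) = T x) : Function.Involutive fun x => x + T x := by
  intro x
  rcases hT x with h | h
  · simp [h]
  · simp only [h, hper]
    grind

/-- The difference function of `x ↦ σ x * x` in direction `a` with factor `c` is injective. -/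
lemma injective_cDifference (hσ : ∀ x, σ (σ x) = x → σ x = x) {c : K} (hc : σ c = c)
    (hc1 : c ≠ 1) (a : K) :
    Function.Injective fun y => σ (y + a) * (y + a) + c * (σ y * y) := by
  intro y z hyz
  have hc2 : 1 + c ≠ 0 := by grind
  obtain ⟨A, rfl⟩ : ∃ A, a = (1 + c) * A := ⟨a / (1 + c), by field_simp⟩
  have key : σ (y + A) * (y + A) = σ (z + A) * (z + A) := by
    apply mul_left_cancel₀ hc2
    simp only [map_add, map_mul, map_one, hc] at hyz ⊢
    grind
  exact add_right_cancel (injective_map_mul_self hσ key)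

/-- After the substitution `y = x + T x`, the shifted argument differs from `y + a` by a constant
in `{0, 1}`. -/
lemma shear_add_eq {T : K → K} (hT : ∀ x, T x = 0 ∨ T x = 1) (hper : ∀ x, T (x + 1) = T x)
    (x a : K) : x + a + T (x + a) = (x + T x) + a + (T (x + T x) + T (x + T x + a)) := by
  rcases hT x with h | h
  · simp only [h, add_zero]
    grind
  · have : x + 1 + a = x + a + 1 := by ring
    simp only [h, this, hper]
    grind

/-- Each equation `G (x + a) + c * G x = b` has at most two solutions. -/
lemma card_solutions_le_two [Finite K] (hσ : ∀ x, σ (σ x) = x → σ x = x) {c : K} (hc : σ c = c)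
    (hc1 : c ≠ 1) {T G : K → K} (hT : ∀ x, T x = 0 ∨ T x = 1) (hper : ∀ x, T (x + 1) = T x)
    (hG : ∀ x, G x = σ (x + T x) * (x + T x)) (a b : K) :
    Nat.card {x : K // G (x + a) + c * G x = b} ≤ 2 := by
  classical
  let shift : K → K := fun x => T (x + T x) + T (x + T x + a)
  have hshift : ∀ x, shift x = 0 ∨ shift x = 1 := by
    intro x
    have h1 := hT (x + T x)
    have h2 := hT (x + T x + a)
    simp only [shift]
    grind
  let f : {x : K // G (x + a) + c * G x = b} → Bool := fun x => decide (shift x = 0)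
  have hf : Function.Injective f := by
    rintro ⟨x, hx⟩ ⟨z, hz⟩ hxz
    have heq : shift x = shift z := by
      have := hshift x
      have := hshift z
      simp only [f, decide_eq_decide] at hxz
      grind
    have hform : ∀ x, G (x + a) + c * G x
        = σ (x + T x + (a + shift x)) * (x + T x + (a + shift x))
          + c * (σ (x + T x) * (x + T x)) := by
      intro x
      rw [hG, hG, shear_add_eq hT hper x a, add_assoc (x + T x)]
    rw [hform] at hx hz
    rw [heq] at hx
    have := injective_cDifference hσ hc hc1 (a + shift z) (hx.trans hz.symm)
    exact Subtype.ext ((involutive_add_of_periodic hT hper).injective this)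
  simpa using Nat.card_le_card_of_injective f hf

/-- A pair `u₀, u₁` satisfying the two trace conditions yields two solutions of one equation
`G (x + a) + c * G x = b`. -/
lemma exists_two_solutions {c : K} (hc : σ c = c) (hc1 : c ≠ 1) (htrσ : ∀ x, tr (σ x) = tr x)
    {T G : K → K} (hT : ∀ x, T x = 0 ∨ T x = 1) (hper : ∀ x, T (x + 1) = T x)
    (hpolar : ∀ x y, T (x + y) = T x + T y + tr (σ x * y + x * σ y))
    (hG : ∀ x, G x = σ (x + T x) * (x + T x)) {a u₀ u₁ : K}
    (hu : (1 + c) ^ 2 * (σ u₀ * u₀ + σ u₁ * u₁) = c * (σ a + a + 1))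
    (h₀ : tr (σ u₀ * a + u₀ * σ a) = T a) (h₁ : tr (σ u₁ * a + u₁ * σ a) = T a + 1) :
    ∃ x z, x ≠ z ∧ G (x + a) + c * G x = G (z + a) + c * G z := by
  have hc2 : 1 + c ≠ 0 := by grind
  obtain ⟨e, he⟩ : ∃ e, (1 + c) * e = 1 := ⟨_, mul_inv_cancel₀ hc2⟩
  have hσe : σ e = e := by
    apply mul_left_cancel₀ hc2
    rw [he]
    simpa [hc] using congrArg σ he
  have htre : ∀ u, tr (σ (e * a + u) * a + (e * a + u) * σ a) = tr (σ u * a + u * σ a) := by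
    intro u
    congr 1
    simp only [map_add, map_mul, hσe]
    grind
  have htre1 : tr (σ e * a + e * σ a) = 0 := by
    rw [map_add, hσe, ← htrσ (e * a), map_mul, hσe]
    exact CharTwo.add_self_eq_zero _
  have hvalue : ∀ y, G (y + T y + a) + c * G (y + T y)
      = σ (y + a + (T a + tr (σ y * a + y * σ a))) * (y + a + (T a + tr (σ y * a + y * σ a)))
        + c * (σ y * y) := by
    intro y
    have hinv : y + T y + T (y + T y) = y := involutive_add_of_periodic hT hper y
    have hshear := shear_add_eq hT hper (y + T y) a
    rw [hinv] at hshear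
    rw [hG, hG, hinv, hshear]
    have : T y + T (y + a) = T a + tr (σ y * a + y * σ a) := by
      rw [hpolar]
      grind
    rw [this]
  have hy₀ : T a + tr (σ (e * a + u₀) * a + (e * a + u₀) * σ a) = 0 := by
    rw [htre, h₀]
    exact CharTwo.add_self_eq_zero _
  have hy₁ : T a + tr (σ (e * a + (e + u₁)) * a + (e * a + (e + u₁)) * σ a) = 1 := by
    have hsplit : σ (e + u₁) * a + (e + u₁) * σ a
        = (σ e * a + e * σ a) + (σ u₁ * a + u₁ * σ a) := by
      rw [map_add]
      ring
    rw [htre, hsplit, map_add, htre1, h₁]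
    grind
  refine ⟨(e * a + u₀) + T (e * a + u₀), (e * a + (e + u₁)) + T (e * a + (e + u₁)), ?_, ?_⟩
  · intro h
    have := (involutive_add_of_periodic hT hper).injective h
    rw [this, hy₁] at hy₀
    exact one_ne_zero hy₀
  · rw [hvalue, hvalue, hy₀, hy₁]
    simp only [map_add, map_mul, map_one, map_zero, hσe]
    apply mul_left_cancel₀ hc2
    grind

/-- The trace of the cubic form `v ^ 2 * σ v + v * σ v ^ 2`, scaled by `D`, takes the value one. -/
lemma exists_tr_cubic_eq_one [Finite K] (hσ : ∀ x, σ (σ x) = x → σ x = x)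
    (htr : ∀ x, tr x = 0 ∨ tr x = 1) (htrσ : ∀ x, tr (σ x) = tr x)
    (htr2 : ∀ x, tr (x ^ 2) = tr x) (hnondeg : ∀ z, (∀ w, tr (w * z) = 0) → z = 0)
    (hcard : Nat.card {x : K // σ x = x} * 4 < Nat.card K) {D : K} (hD : σ D = D)
    (hD0 : D ≠ 0) : ∃ v, tr (D * (v ^ 2 * σ v + v * σ v ^ 2)) = 1 := by
  classical
  by_contra! hne
  have hzero : ∀ v, tr (D * (v ^ 2 * σ v + v * σ v ^ 2)) = 0 := fun v =>
    (htr _).resolve_right (hne v)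
  have hpolar : ∀ v w, tr (D * (v ^ 2 * σ w + w ^ 2 * σ v + v * σ w ^ 2 + w * σ v ^ 2)) = 0 := by
    intro v w
    have h := hzero (v + w)
    have hsplit : D * ((v + w) ^ 2 * σ (v + w) + (v + w) * σ (v + w) ^ 2)
        = D * (v ^ 2 * σ v + v * σ v ^ 2) + D * (w ^ 2 * σ w + w * σ w ^ 2)
          + D * (v ^ 2 * σ w + w ^ 2 * σ v + v * σ w ^ 2 + w * σ v ^ 2) := by
      rw [map_add]
      grind
    rwa [hsplit, map_add, map_add, hzero, hzero, zero_add, zero_add] at h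
  have hroot : ∀ x, σ (σ x) + x = D * (σ (σ x) + x) ^ 4 := by
    intro x
    set h := σ (σ x) + x with hh
    have hall : ∀ w, tr (w ^ 2 * (D * h + D ^ 2 * h ^ 4)) = 0 := by
      intro w
      have h0 := hpolar (σ x) w
      have hsplit : D * (σ x ^ 2 * σ w + w ^ 2 * σ (σ x) + σ x * σ w ^ 2 + w * σ (σ x) ^ 2)
          = σ (D * (x ^ 2 * w + x * w ^ 2)) + D * (w ^ 2 * σ (σ x) + w * σ (σ x) ^ 2) := by
        simp only [map_mul, map_add, map_pow, hD]
        ring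
      rw [hsplit, map_add, htrσ, ← map_add] at h0
      have hregroup : D * (x ^ 2 * w + x * w ^ 2) + D * (w ^ 2 * σ (σ x) + w * σ (σ x) ^ 2)
          = w ^ 2 * (D * h) + D * w * h ^ 2 := by
        rw [hh]
        grind
      rw [hregroup, map_add, ← htr2 (D * w * h ^ 2), ← map_add] at h0
      rw [← h0]
      congr 1
      ring
    have hsq : Function.Surjective fun w : K => w ^ 2 :=
      Finite.surjective_of_injective (frobenius_inj K 2)
    have hz := hnondeg (D * h + D ^ 2 * h ^ 4) fun w => by
      obtain ⟨w, rfl⟩ := hsq w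
      exact hall w
    apply mul_left_cancel₀ hD0
    grind
  have := Fintype.ofFinite K
  have himage : (Finset.univ.image fun x => σ (σ x) + x).card ≤ 4 := by
    let p : Polynomial K := Polynomial.C D * Polynomial.X ^ 4 + Polynomial.X
    have hp : p.natDegree = 4 := by
      simp only [p]
      compute_degree!
    have hp0 : p ≠ 0 := by
      intro h
      simp [h] at hp
    refine le_trans ?_ (hp ▸ p.card_roots')
    refine le_trans (Finset.card_le_card ?_) (Multiset.toFinset_card_le _)
    intro y hy
    obtain ⟨x, -, rfl⟩ := Finset.mem_image.1 hy
    have := hroot x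
    simp only [Multiset.mem_toFinset, Polynomial.mem_roots hp0, Polynomial.IsRoot.def, p,
      Polynomial.eval_add, Polynomial.eval_mul, Polynomial.eval_C, Polynomial.eval_pow,
      Polynomial.eval_X]
    grind
  have hfiber := Finset.card_le_mul_card_image (f := fun x => σ (σ x) + x) Finset.univ
    (Nat.card {x : K // σ x = x}) (by
      intro b hb
      obtain ⟨x₀, -, rfl⟩ := Finset.mem_image.1 hb
      rw [Nat.card_eq_fintype_card, Fintype.card_subtype]
      apply Finset.card_le_card_of_injOn (fun x => x + x₀)
      · intro x hx
        simp only [Finset.coe_filter, Finset.mem_univ, true_and, Set.mem_ofPred_eq] at hx ⊢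
        apply hσ
        simp only [map_add]
        grind
      · intro x _ y _ hxy
        exact add_right_cancel hxy)
  rw [Finset.card_univ, ← Nat.card_eq_fintype_card] at hfiber
  exact absurd (hfiber.trans (Nat.mul_le_mul_left _ himage)) (not_le.2 hcard)

/-- Some equation `G (x + a) + c * G x = b` has two distinct solutions. -/
lemma exists_cDifference_collision [Finite K] (hσ : ∀ x, σ (σ x) = x → σ x = x)
    (htr : ∀ x, tr x = 0 ∨ tr x = 1) (htrσ : ∀ x, tr (σ x) = tr x)
    (htr2 : ∀ x, tr (x ^ 2) = tr x) (hnondeg : ∀ z, (∀ w, tr (w * z) = 0) → z = 0)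
    (hcard : Nat.card {x : K // σ x = x} * 4 < Nat.card K) {k : ℕ}
    (hord : ∀ x, σ^[2 * k + 1] x = x) {c : K} (hc : σ c = c) (hc0 : c ≠ 0) (hc1 : c ≠ 1)
    {T G : K → K} (hT : ∀ x, T x = 0 ∨ T x = 1) (hper : ∀ x, T (x + 1) = T x)
    (hpolar : ∀ x y, T (x + y) = T x + T y + tr (σ x * y + x * σ y))
    (hG : ∀ x, G x = σ (x + T x) * (x + T x)) :
    ∃ a x z, x ≠ z ∧ G (x + a) + c * G x = G (z + a) + c * G z := by
  have hc2 : 1 + c ≠ 0 := by grind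
  obtain ⟨D, hDc⟩ : ∃ D, c * D = (1 + c) ^ 2 := ⟨(1 + c) ^ 2 / c, by field_simp⟩
  have hD : σ D = D := by
    apply mul_left_cancel₀ hc0
    rw [hDc]
    simpa [hc] using congrArg σ hDc
  have hD0 : D ≠ 0 := by
    rintro rfl
    exact pow_ne_zero 2 hc2 (by rw [← hDc, mul_zero])
  obtain ⟨v, hv⟩ := exists_tr_cubic_eq_one hσ htr htrσ htr2 hnondeg hcard hD hD0
  obtain ⟨a, r, hr, ha⟩ := exists_map_add_add_fixed hord (D * (σ v * v))
  have hav : tr (σ v * a + v * σ a) = 1 := by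
    have hsecond : σ (σ a) + a = D * (σ (σ v) * σ v) + D * (σ v * v) := by
      have := congrArg σ ha
      simp only [map_add, map_mul, hD, hr] at this
      grind
    rw [map_add, ← htrσ (v * σ a), ← map_add, map_mul]
    have hregroup : σ v * a + σ v * σ (σ a) = σ (D * (v ^ 2 * σ v)) + D * (v * σ v ^ 2) := by
      simp only [map_mul, map_pow, hD]
      grind
    rw [hregroup, map_add, htrσ, ← map_add, ← mul_add, hv]
  have hsq : Function.Surjective fun w : K => w ^ 2 :=
    Finite.surjective_of_injective (frobenius_inj K 2)
  obtain ⟨t, ht⟩ := hsq ((r + 1) / D)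
  have ht' : D * t ^ 2 = r + 1 := by
    simp only at ht
    rw [ht]
    field_simp
  have hσt : σ t = t := by
    apply frobenius_inj K 2
    apply mul_left_cancel₀ hD0
    simp only [frobenius_def]
    have := congrArg σ ht'
    simp only [map_mul, map_pow, map_add, map_one, hD, hr] at this
    rw [this, ht']
  have hta : tr (σ t * a + t * σ a) = 0 := by
    rw [map_add, ← htrσ (σ t * a), map_mul, hσt, hσt]
    exact CharTwo.add_self_eq_zero _
  have hsum : (1 + c) ^ 2 * (σ v * v + σ t * t) = c * (σ a + a + 1) := by
    rw [← hDc, hσt]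
    grind
  rcases hT a with h | h
  · exact ⟨a, exists_two_solutions hc hc1 htrσ hT hper hpolar hG (u₀ := t) (u₁ := v)
      (by rw [add_comm (σ t * t), hsum]) (by rw [hta, h]) (by rw [hav, h, zero_add])⟩
  · exact ⟨a, exists_two_solutions hc hc1 htrσ hT hper hpolar hG (u₀ := v) (u₁ := t) hsum
      (by rw [hav, h]) (by rw [hta, h, CharTwo.add_self_eq_zero])⟩

end CharTwo

section Trace

variable {K : Type} [Field K] {n : ℕ}

lemma aTr_add [CharP K 2] (x y : K) : aTr n (x + y) = aTr n x + aTr n y := by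
  simp only [aTr, add_pow_char_pow, Finset.sum_add_distrib]

lemma aTr_sq (hn : ∀ x : K, x ^ 2 ^ n = x) (x : K) : aTr n (x ^ 2) = aTr n x := by
  have h : aTr n (x ^ 2) + x = aTr n x + x ^ 2 ^ n := by
    simp only [aTr]
    rw [← Finset.sum_range_succ, Finset.sum_range_succ']
    simp only [← pow_mul, ← pow_succ', pow_zero, pow_one]
  rw [hn] at h
  exact add_right_cancel h

lemma aTr_pow_two_pow (hn : ∀ x : K, x ^ 2 ^ n = x) (i : ℕ) (x : K) :
    aTr n (x ^ 2 ^ i) = aTr n x := by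
  induction i with
  | zero => simp
  | succ i ih => rw [pow_succ, pow_mul, aTr_sq hn, ih]

lemma aTr_eq_zero_or_one [CharP K 2] (hn : ∀ x : K, x ^ 2 ^ n = x) (x : K) :
    aTr n x = 0 ∨ aTr n x = 1 := by
  have h : aTr n x ^ 2 = aTr n x := by
    conv_rhs => rw [← aTr_sq hn]
    simp only [aTr, sum_pow_char, ← pow_mul, mul_comm]
  have : aTr n x * (aTr n x - 1) = 0 := by
    rw [mul_sub, ← sq, h]
    ring
  rcases mul_eq_zero.1 this with h | h
  · exact .inl h
  · exact .inr (sub_eq_zero.1 h)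

end Trace

lemma GaloisField.aTr_nondegenerate {n : ℕ} (hn : n ≠ 0) (z : GaloisField 2 n)
    (hz : ∀ w, aTr n (w * z) = 0) : z = 0 := by
  refine (traceForm_nondegenerate (ZMod 2) (GaloisField 2 n)).2 z fun w => ?_
  apply (algebraMap (ZMod 2) (GaloisField 2 n)).injective
  rw [Algebra.traceForm_apply, FiniteField.algebraMap_trace_eq_sum_pow, GaloisField.finrank 2 hn,
    Nat.card_zmod, map_zero]
  exact hz w

lemma pow_two_pow_gcd_eq_self {K : Type} [Field K] [CharP K 2] {x : K} {i j : ℕ}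
    (hi : x ^ 2 ^ i = x) (hj : x ^ 2 ^ j = x) : x ^ 2 ^ Nat.gcd i j = x := by
  rw [← iterate_frobenius] at hi hj ⊢
  exact Function.IsPeriodicPt.gcd hi hj

lemma pow_two_pow_eq_self_of_dvd {K : Type} [Field K] [CharP K 2] {x : K} {i j : ℕ}
    (hi : x ^ 2 ^ i = x) (hij : i ∣ j) : x ^ 2 ^ j = x := by
  rw [← iterate_frobenius] at hi ⊢
  exact Function.IsPeriodicPt.trans_dvd hi hij

lemma card_pow_two_pow_fixed_le {K : Type} [Field K] [Finite K] {d : ℕ} (hd : d ≠ 0) :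
    Nat.card {x : K // x ^ 2 ^ d = x} ≤ 2 ^ d := by
  classical
  have := Fintype.ofFinite K
  have h1 : 1 < 2 ^ d := Nat.one_lt_two_pow hd
  rw [Nat.card_eq_fintype_card, Fintype.card_subtype]
  conv_rhs => rw [← FiniteField.X_pow_card_sub_X_natDegree_eq K h1]
  refine le_trans ?_ (Polynomial.card_roots' _)
  refine le_trans (Finset.card_le_card ?_) (Multiset.toFinset_card_le _)
  intro x hx
  simpa [Polynomial.mem_roots (FiniteField.X_pow_card_sub_X_ne_zero K h1), sub_eq_zero] using hx

/-- for `α ∈ F_{2^n}` with `tr(α+1) = 0` and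
`d = gcd(2i,n) = gcd(i,n) < n`, for every `c ∈ F_{2^d} \ F_2` the function
`G_α(x) = (x + tr(αx + x^{2^i+1}))^{2^i+1}` is an APcN permutation of `F_{2^n}`. -/
theorem stmt19 (n i d : ℕ) (α : GaloisField 2 n) (hα : aTr n (α + 1) = 0)
    (hd2 : d = Nat.gcd (2 * i) n) (hd1 : d = Nat.gcd i n) (hdn : d < n) :
    ∀ c : GaloisField 2 n, c ^ 2 ^ d = c → c ≠ 0 → c ≠ 1 →
      Function.Bijective
        (fun x : GaloisField 2 n =>
          (x + aTr n (α * x + x ^ (2 ^ i + 1))) ^ (2 ^ i + 1)) ∧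
      cDelta c
        (fun x : GaloisField 2 n =>
          (x + aTr n (α * x + x ^ (2 ^ i + 1))) ^ (2 ^ i + 1)) = 2 := by
  intro c hcd hc0 hc1
  have hn0 : n ≠ 0 := by omega
  have hcardK : Nat.card (GaloisField 2 n) = 2 ^ n := GaloisField.card 2 n hn0
  have hn : ∀ x : GaloisField 2 n, x ^ 2 ^ n = x := by
    intro x
    have := Fintype.ofFinite (GaloisField 2 n)
    rw [← hcardK, Nat.card_eq_fintype_card]
    exact FiniteField.pow_card x
  have hdi : d ∣ i := hd1 ▸ Nat.gcd_dvd_left i n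
  obtain ⟨m, hm⟩ : d ∣ n := hd1 ▸ Nat.gcd_dvd_right i n
  have hd0 : d ≠ 0 := by
    rintro rfl
    omega
  have hdne1 : d ≠ 1 := by
    rintro rfl
    have : c * (c - 1) = 0 := by
      rw [mul_sub, ← sq]
      simpa [sub_eq_zero] using hcd
    exact (mul_ne_zero hc0 (sub_ne_zero.2 hc1)) this
  have hodd : Odd m := by
    rw [← Nat.not_even_iff_odd]
    rintro ⟨l, hl⟩
    have h : d * 2 ∣ d := by
      conv_rhs => rw [hd2]
      refine Nat.dvd_gcd ?_ ⟨l, by rw [hm, hl]; ring⟩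
      rw [mul_comm]
      exact Nat.mul_dvd_mul_left 2 hdi
    have := Nat.le_of_dvd (by omega) h
    omega
  obtain ⟨k, rfl⟩ := hodd
  have hk : k ≠ 0 := by
    rintro rfl
    omega
  let σ := iterateFrobenius (GaloisField 2 n) 2 i
  have hσdef : ∀ x, σ x = x ^ 2 ^ i := iterateFrobenius_def 2 i
  let tr : GaloisField 2 n →+ GaloisField 2 n := AddMonoidHom.mk' (aTr n) aTr_add
  have htrdef : ∀ x, tr x = aTr n x := fun _ => rfl
  have hσ : ∀ x, σ (σ x) = x → σ x = x := by
    intro x hx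
    rw [hσdef, hσdef, ← pow_mul, ← pow_add, ← two_mul] at hx
    rw [hσdef]
    have := pow_two_pow_gcd_eq_self hx (hn x)
    rw [← hd2] at this
    exact pow_two_pow_eq_self_of_dvd this hdi
  have hfixed : Nat.card {x // σ x = x} ≤ 2 ^ d := by
    refine le_trans (Nat.card_le_card_of_injective
      (Subtype.map id fun x hx => ?_) (Subtype.map_injective _ Function.injective_id))
      (card_pow_two_pow_fixed_le (K := GaloisField 2 n) hd0)
    have h := pow_two_pow_gcd_eq_self ((hσdef x).symm.trans hx) (hn x)
    rwa [← hd1] at h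
  have hcard : Nat.card {x // σ x = x} * 4 < Nat.card (GaloisField 2 n) := by
    rw [hcardK]
    calc Nat.card {x // σ x = x} * 4 ≤ 2 ^ d * 2 ^ 2 := Nat.mul_le_mul_right _ hfixed
      _ = 2 ^ (d + 2) := (pow_add 2 d 2).symm
      _ < 2 ^ n := by
        apply Nat.pow_lt_pow_right (by norm_num)
        have : d * 3 ≤ d * (2 * k + 1) := Nat.mul_le_mul_left d (by omega)
        omega
  have hord : ∀ x, σ^[2 * k + 1] x = x := by
    intro x
    have hiter : ∀ j, σ^[j] x = x ^ 2 ^ (i * j) := by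
      intro j
      induction j with
      | zero => simp
      | succ j ih => rw [Function.iterate_succ_apply', ih, hσdef, ← pow_mul, ← pow_add, mul_add_one]
    rw [hiter]
    exact pow_two_pow_eq_self_of_dvd (hn x) (hm ▸ Nat.mul_dvd_mul_right hdi _)
  have hc : σ c = c := by
    rw [hσdef]
    exact pow_two_pow_eq_self_of_dvd hcd hdi
  have htr : ∀ x, tr x = 0 ∨ tr x = 1 := aTr_eq_zero_or_one hn
  have htrσ : ∀ x, tr (σ x) = tr x := fun x => by
    rw [hσdef]
    exact aTr_pow_two_pow hn i x
  let T : GaloisField 2 n → GaloisField 2 n := fun x => tr (α * x + σ x * x)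
  have hT : ∀ x, T x = 0 ∨ T x = 1 := fun x => htr _
  have hpolar : ∀ x y, T (x + y) = T x + T y + tr (σ x * y + x * σ y) := by
    intro x y
    simp only [T, ← map_add]
    congr 1
    rw [map_add]
    ring
  have hper : ∀ x, T (x + 1) = T x := by
    intro x
    have hT1 : T 1 = 0 := by
      simpa [T, htrdef] using hα
    rw [hpolar, hT1, map_one, mul_one, mul_one, map_add, htrσ, CharTwo.add_self_eq_zero, add_zero,
      add_zero]
  set G : GaloisField 2 n → GaloisField 2 n :=
    fun x => (x + aTr n (α * x + x ^ (2 ^ i + 1))) ^ (2 ^ i + 1) with hGdef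
  have hG : ∀ x, G x = σ (x + T x) * (x + T x) := by
    intro x
    simp only [hGdef, T, htrdef, hσdef, pow_succ]
  have hupper := card_solutions_le_two hσ hc hc1 hT hper hG
  refine ⟨Finite.injective_iff_bijective.1 fun x y hxy => ?_, IsGreatest.csSup_eq ⟨?_, ?_⟩⟩
  · rw [hG, hG] at hxy
    exact (involutive_add_of_periodic hT hper).injective (injective_map_mul_self hσ hxy)
  · obtain ⟨a, x, z, hxz, heq⟩ := exists_cDifference_collision hσ htr htrσ (aTr_sq hn)
      (GaloisField.aTr_nondegenerate hn0) hcard hord hc hc0 hc1 hT hper hpolar hG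
    refine ⟨a, G (z + a) + c * G z, fun h => absurd h hc1, le_antisymm ?_ (hupper _ _)⟩
    have : Nontrivial {x // G (x + a) + c * G x = G (z + a) + c * G z} :=
      ⟨⟨x, heq⟩, ⟨z, rfl⟩, fun h => hxz (congrArg Subtype.val h)⟩
    exact Finite.one_lt_card
  · rintro _ ⟨a, b, -, rfl⟩
    exact hupper a b
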